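/- For every σ ∈ S_r, there is a unique R-algebra automorphism of H_{n,r} sending b_{k_1,…,k_n} ↦ b_{σ(k_1),…,σ(k_n)} for all (k_1,…,k_n) ∈ [1,r]^n and g_i ↦ g_i for all 1 ≤ i ≤ n−1; moreover, these automorphisms define an action of the symmetric group S_r on H_{n,r} by R-algebra automorphisms. -/

import Mathlib

open Polynomial

namespace MAK

noncomputable section

variable (R : Type*) [CommRing R] (n r : ℕ) (q Δ : Rˣ) (u : Fin r → R) (F : Fin r → R[X])

/-- The free `R`-algebra on generators `t_1, …, t_n` (left) and `T_1, …, T_{n-1}` (right). -/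
abbrev FA := FreeAlgebra R (Fin n ⊕ Fin (n - 1))

/-- The generators `t_i`. -/
def tf (i : Fin n) : FA R n := FreeAlgebra.ι R (Sum.inl i)

/-- The generators `T_j`. -/
def Tf (j : Fin (n - 1)) : FA R n := FreeAlgebra.ι R (Sum.inr j)

/-- The index `j`, viewed in `Fin n`. -/
def lo (j : Fin (n - 1)) : Fin n := ⟨j.1, by have := j.2; omega⟩

/-- The index `j + 1`, viewed in `Fin n`. -/
def hi (j : Fin (n - 1)) : Fin n := ⟨j.1 + 1, by have := j.2; omega⟩

/-- The element `B_j = Δ⁻² Σ_{c1<c2} (u_{c2} - u_{c1})(q - q⁻¹) F_{c1}(t_j) F_{c2}(t_{j+1})`. -/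
def Bel (j : Fin (n - 1)) : FA R n :=
  ∑ c2 : Fin r, ∑ c1 ∈ Finset.univ.filter (fun c1 => c1 < c2),
    (((Δ⁻¹ : Rˣ) : R) ^ 2 * ((u c2 - u c1) * ((q : R) - ((q⁻¹ : Rˣ) : R)))) •
      (aeval (tf R n (lo n j)) (F c1) * aeval (tf R n (hi n j)) (F c2))

/-- The defining relations of the modified Ariki-Koike algebra. -/
inductive Rel : FA R n → FA R n → Prop
  | quad (j : Fin (n - 1)) :
      Rel ((Tf R n j - algebraMap R (FA R n) (q : R)) *
        (Tf R n j + algebraMap R (FA R n) ((q⁻¹ : Rˣ) : R))) 0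
  | tord (i : Fin n) : Rel (aeval (tf R n i) (∏ c : Fin r, (X - C (u c)))) 0
  | braid (j k : Fin (n - 1)) (h : k.1 = j.1 + 1) :
      Rel (Tf R n j * Tf R n k * Tf R n j) (Tf R n k * Tf R n j * Tf R n k)
  | Tcomm (j k : Fin (n - 1)) (h : j.1 + 2 ≤ k.1 ∨ k.1 + 2 ≤ j.1) :
      Rel (Tf R n j * Tf R n k) (Tf R n k * Tf R n j)
  | tcomm (i i' : Fin n) : Rel (tf R n i * tf R n i') (tf R n i' * tf R n i)
  | Tt (j : Fin (n - 1)) (i : Fin n) (h1 : i ≠ lo n j) (h2 : i ≠ hi n j) :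
      Rel (Tf R n j * tf R n i) (tf R n i * Tf R n j)
  | Thi (j : Fin (n - 1)) :
      Rel (Tf R n j * tf R n (hi n j)) (tf R n (lo n j) * Tf R n j + Bel R n r q Δ u F j)
  | Tlo (j : Fin (n - 1)) :
      Rel (Tf R n j * tf R n (lo n j)) (tf R n (hi n j) * Tf R n j - Bel R n r q Δ u F j)

/-- The modified Ariki-Koike algebra `H_{n,r}(R, q, u_1, …, u_r)`. -/
abbrev Hnr := RingQuot (Rel R n r q Δ u F)

/-- The canonical projection. -/
def pim : FA R n →ₐ[R] Hnr R n r q Δ u F := RingQuot.mkAlgHom R (Rel R n r q Δ u F)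

/-- The generator `t_i` of `H_{n,r}`. -/
def tt (i : Fin n) : Hnr R n r q Δ u F := pim R n r q Δ u F (tf R n i)

/-- The generator `T_j` of `H_{n,r}`. -/
def TT (j : Fin (n - 1)) : Hnr R n r q Δ u F := pim R n r q Δ u F (Tf R n j)

/-- The Lagrange basis polynomial `∏_{j ≠ c} (X - u_j)/(u_c - u_j)`. -/
def bpoly (c : Fin r) : R[X] :=
  ∏ j ∈ Finset.univ.filter (fun j => j ≠ c), Ring.inverse (u c - u j) • (X - C (u j))

/-- The idempotent `b_{k_1, …, k_n}`. -/
def b (k : Fin n → Fin r) : Hnr R n r q Δ u F :=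
  (List.ofFn fun i : Fin n => aeval (tt R n r q Δ u F i) (bpoly R r u (k i))).prod

/-- The element `B'_{i,j} = -(q - q⁻¹) Σ_{k_i < k_j} b_{k_1, …, k_n}`. -/
def B' (i j : Fin n) : Hnr R n r q Δ u F :=
  -(((q : R) - ((q⁻¹ : Rˣ) : R)) •
    ∑ k ∈ Finset.univ.filter (fun k : Fin n → Fin r => k i < k j), b R n r q Δ u F k)

/-- The element `g_i := T_i + B'_{i,i+1}`. -/
def g (j : Fin (n - 1)) : Hnr R n r q Δ u F :=
  TT R n r q Δ u F j + B' R n r q Δ u F (lo n j) (hi n j)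

/-- The idempotent `e_{i,j} = Σ_{k_i = k_j} b_{k_1, …, k_n}`. -/
def eij (i j : Fin n) : Hnr R n r q Δ u F :=
  ∑ k ∈ Finset.univ.filter (fun k : Fin n → Fin r => k i = k j), b R n r q Δ u F k

/-- The idempotent `e_i = e_{i,i+1}`. -/
def ee (j : Fin (n - 1)) : Hnr R n r q Δ u F := eij R n r q Δ u F (lo n j) (hi n j)

/-- The simple transposition `s_j = (j, j+1)` in `S_n`. -/
def simple (j : Fin (n - 1)) : Equiv.Perm (Fin n) := Equiv.swap (lo n j) (hi n j)

/-- `l` is a reduced word for the permutation `w`. -/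
def IsReducedWord (w : Equiv.Perm (Fin n)) (l : List (Fin (n - 1))) : Prop :=
  (l.map (simple n)).prod = w ∧
    ∀ l' : List (Fin (n - 1)), (l'.map (simple n)).prod = w → l.length ≤ l'.length

/-- The element `g_w = g_{i_1} ⋯ g_{i_l}` associated to a word `l = (i_1, …, i_l)`. -/
def gword (l : List (Fin (n - 1))) : Hnr R n r q Δ u F := (l.map (g R n r q Δ u F)).prod

/-- The element `T_w = T_{i_1} ⋯ T_{i_l}` associated to a word `l = (i_1, …, i_l)`. -/
def Tword (l : List (Fin (n - 1))) : Hnr R n r q Δ u F := (l.map (TT R n r q Δ u F)).prod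

/-- The monomial `t_1^{c_1} ⋯ t_n^{c_n}`. -/
def tmon (c : Fin n → ℕ) : Hnr R n r q Δ u F :=
  (List.ofFn fun i : Fin n => tt R n r q Δ u F i ^ c i).prod

end

end MAK

open MAK

namespace MAK

noncomputable section

/-- The defect of the braid relation for `g₁` and `g₂` is the same as that for `g₁ + p12` and
`g₂ + p23`. -/
theorem braid_sub_braid {A : Type*} [Ring A]
    (g₁ g₂ p12 p13 p23 p21 p32 e12 e23 : A)
    (h1_23 : g₁ * p23 = p13 * g₁) (h1_12 : g₁ * p12 = p21 * g₁)
    (h1_13 : g₁ * p13 = p23 * g₁) (h2_12 : g₂ * p12 = p13 * g₂)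
    (h2_13 : g₂ * p13 = p12 * g₂) (h2_23 : g₂ * p23 = p32 * g₂)
    (hq1 : g₁ * g₁ = 1 + e12 * g₁) (hq2 : g₂ * g₂ = 1 + e23 * g₂)
    (hc1 : p13 * e12 + p12 * p23 + p13 * p21 = p23 * p13)
    (hc2 : p12 * p13 = p13 * e23 + p23 * p12 + p13 * p32)
    (hb : p12 * p23 * p12 = p23 * p12 * p23) :
    (g₁ + p12) * (g₂ + p23) * (g₁ + p12) - (g₂ + p23) * (g₁ + p12) * (g₂ + p23) =
      g₁ * g₂ * g₁ - g₂ * g₁ * g₂ := by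
  have a1 : g₁ * p23 * g₁ = p13 + p13 * e12 * g₁ := by
    rw [h1_23, mul_assoc, hq1]; noncomm_ring
  have a2 : g₁ * g₂ * p12 = p23 * g₁ * g₂ := by
    rw [mul_assoc, h2_12, ← mul_assoc, h1_13]
  have a3 : p12 * g₂ * p12 = p12 * p13 * g₂ := by rw [mul_assoc, h2_12, ← mul_assoc]
  have a4 : g₁ * p23 * p12 = p13 * p21 * g₁ := by
    rw [h1_23, mul_assoc, h1_12, ← mul_assoc]
  have b1 : g₂ * p12 * g₂ = p13 + p13 * e23 * g₂ := by
    rw [h2_12, mul_assoc, hq2]; noncomm_ring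
  have b2 : g₂ * g₁ * p23 = p12 * g₂ * g₁ := by
    rw [mul_assoc, h1_23, ← mul_assoc, h2_13]
  have b3 : p23 * g₁ * p23 = p23 * p13 * g₁ := by rw [mul_assoc, h1_23, ← mul_assoc]
  have b4 : g₂ * p12 * p23 = p13 * p32 * g₂ := by
    rw [h2_12, mul_assoc, h2_23, ← mul_assoc]
  have c1 := congrArg (· * g₁) hc1
  have c2 := congrArg (· * g₂) hc2
  simp only [add_mul] at c1 c2
  have l : (g₁ + p12) * (g₂ + p23) * (g₁ + p12) =
      g₁ * g₂ * g₁ + p12 * g₂ * g₁ + g₁ * p23 * g₁ + g₁ * g₂ * p12 + p12 * p23 * g₁ +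
        p12 * g₂ * p12 + g₁ * p23 * p12 + p12 * p23 * p12 := by noncomm_ring
  have r : (g₂ + p23) * (g₁ + p12) * (g₂ + p23) =
      g₂ * g₁ * g₂ + p23 * g₁ * g₂ + g₂ * p12 * g₂ + g₂ * g₁ * p23 + p23 * p12 * g₂ +
        p23 * g₁ * p23 + g₂ * p12 * p23 + p23 * p12 * p23 := by noncomm_ring
  rw [l, r, a1, a2, a3, a4, b1, b2, b3, b4, hb, ← c1, c2]
  abel

section ListProd

variable {R A : Type*} [CommRing R] [Ring A] [Algebra R A]

theorem prod_ofFn_mul_of_forall {n : ℕ} (f : Fin n → A) (s : Fin n → R) (y : A)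
    (h : ∀ i, f i * y = s i • y) : (List.ofFn f).prod * y = (∏ i, s i) • y := by
  induction n with
  | zero => simp
  | succ n ih =>
    rw [List.ofFn_succ, List.prod_cons, mul_assoc, ih (fun i => f i.succ) (fun i => s i.succ)
      (fun i => h i.succ), mul_smul_comm, h 0, smul_smul, Fin.prod_univ_succ, mul_comm]

theorem mul_prod_ofFn_of_commute {n : ℕ} (f : Fin n → A) (s : R) (x : A)
    (hc : ∀ i, x * f i = f i * x) (i : Fin n) (h : x * f i = s • f i) :
    x * (List.ofFn f).prod = s • (List.ofFn f).prod := by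
  induction n with
  | zero => exact i.elim0
  | succ n ih =>
    rw [List.ofFn_succ, List.prod_cons, ← mul_assoc]
    induction i using Fin.cases with
    | zero => rw [h, smul_mul_assoc]
    | succ i =>
      rw [hc 0, mul_assoc, ih (fun i => f i.succ) (fun i => hc i.succ) i h, mul_smul_comm]

theorem prod_ofFn_sum {n : ℕ} {α : Type*} [Fintype α] (f : Fin n → α → A) :
    (List.ofFn fun i => ∑ c, f i c).prod =
      ∑ k : Fin n → α, (List.ofFn fun i => f i (k i)).prod := by
  induction n with
  | zero => simp
  | succ n ih =>
    rw [List.ofFn_succ, List.prod_cons, ih (fun i => f i.succ), Finset.sum_mul_sum,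
      ← (Fin.consEquiv (fun _ => α)).sum_comp, Fintype.sum_prod_type]
    simp [List.ofFn_succ, Fin.consEquiv]

theorem commute_aeval {x y : A} (h : Commute x y) (p : R[X]) : Commute x (aeval y p) := by
  induction p using Polynomial.induction_on' with
  | add p p' hp hp' => rw [map_add]; exact hp.add_right hp'
  | monomial m c =>
    rw [aeval_monomial]
    exact (Algebra.commute_algebraMap_right c x).mul_right (h.pow_right m)

theorem aeval_mul_of_mul_eq_smul {x y : A} {s : R} (h : x * y = s • y) (p : R[X]) :
    aeval x p * y = p.eval s • y := by
  induction p using Polynomial.induction_on' with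
  | add p p' hp hp' => simp [add_mul, add_smul, hp, hp']
  | monomial m c =>
    have hm : x ^ m * y = s ^ m • y := by
      induction m with
      | zero => simp
      | succ m ih => rw [pow_succ, mul_assoc, h, mul_smul_comm, ih, smul_smul, pow_succ']
    rw [aeval_monomial, mul_assoc, hm, eval_monomial, ← Algebra.smul_def, smul_smul]

end ListProd

section Functions

variable {R : Type*} [CommRing R] {n r : ℕ} (q Δ : Rˣ) (u : Fin r → R) (F : Fin r → R[X])

/-- The function `k ↦ u_{k_i}` on the set of labels. -/
def coord (i : Fin n) : (Fin n → Fin r) → R := fun k => u (k i)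

/-- The function `q - q⁻¹` times the indicator of `k_i < k_j`. -/
def ltFun (i j : Fin n) : (Fin n → Fin r) → R :=
  fun k => if k i < k j then (q : R) - ((q⁻¹ : Rˣ) : R) else 0

/-- The function `q - q⁻¹` times the indicator of `k_i = k_j`. -/
def eqFun (i j : Fin n) : (Fin n → Fin r) → R :=
  fun k => if k i = k j then (q : R) - ((q⁻¹ : Rˣ) : R) else 0

theorem aeval_pi_apply {ι : Type*} (x : ι → R) (p : R[X]) (k : ι) :
    aeval x p k = p.eval (x k) := by
  simp

theorem isUnit_sub_of_prod
    (hΔ : (Δ : R) = ∏ i : Fin r, ∏ j ∈ Finset.univ.filter (fun j => j < i), (u i - u j))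
    {i j : Fin r} (hij : i ≠ j) : IsUnit (u i - u j) := by
  have key : ∀ i j : Fin r, j < i → IsUnit (u i - u j) := fun i j h => by
    refine isUnit_of_dvd_unit ?_ Δ.isUnit
    rw [hΔ]
    exact (Finset.dvd_prod_of_mem (fun j => u i - u j) (by simpa using h)).trans
      (Finset.dvd_prod_of_mem
        (fun i => ∏ j ∈ Finset.univ.filter (fun j => j < i), (u i - u j)) (Finset.mem_univ i))
  rcases lt_or_gt_of_ne hij with h | h
  · rw [← neg_sub]; exact (key _ _ h).neg
  · exact key _ _ h

theorem bpoly_eval (hu : ∀ i j, i ≠ j → IsUnit (u i - u j)) (c c' : Fin r) :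
    (bpoly R r u c).eval (u c') = if c' = c then 1 else 0 := by
  rw [bpoly, eval_prod]
  split_ifs with h
  · subst h
    refine Finset.prod_eq_one fun j hj => ?_
    have : c' ≠ j := by simpa [eq_comm] using hj
    simp [Ring.inverse_mul_cancel _ (hu _ _ this)]
  · exact Finset.prod_eq_zero (i := c') (by simpa using h) (by simp)

theorem sub_mul_bpoly (c : Fin r) :
    ∃ s : R, (X - C (u c)) * bpoly R r u c = s • ∏ c : Fin r, (X - C (u c)) := by
  refine ⟨∏ j ∈ Finset.univ.filter (fun j => j ≠ c), Ring.inverse (u c - u j), ?_⟩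
  rw [bpoly, Finset.prod_smul, mul_smul_comm]
  congr 1
  rw [← Finset.mul_prod_erase _ _ (Finset.mem_univ c), Finset.filter_ne']

theorem bpoly_degree_lt [IsDomain R] (hr : 1 ≤ r) (c : Fin r) :
    (bpoly R r u c).degree < (r : WithBot ℕ) := by
  have h : (bpoly R r u c).natDegree ≤ r - 1 := by
    refine (natDegree_prod_le _ _).trans ?_
    calc _ ≤ ∑ _j ∈ Finset.univ.filter (fun j => j ≠ c), 1 :=
          Finset.sum_le_sum fun j _ => (natDegree_smul_le _ _).trans (by simp)
      _ = r - 1 := by simp [Finset.filter_ne', Finset.card_erase_of_mem]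
  refine degree_le_natDegree.trans_lt ?_
  exact_mod_cast (by omega : (bpoly R r u c).natDegree < r)

theorem sum_bpoly [IsDomain R] (hr : 1 ≤ r) (hu : ∀ i j, i ≠ j → IsUnit (u i - u j)) :
    ∑ c, bpoly R r u c = 1 := by
  have hinj : Set.InjOn u (Finset.univ : Finset (Fin r)) := fun i _ j _ h => by
    by_contra hij
    exact (hu i j hij).ne_zero (sub_eq_zero.2 h)
  refine Polynomial.eq_of_degrees_lt_of_eval_index_eq Finset.univ hinj ?_ ?_ ?_
  · refine (degree_sum_le _ _).trans_lt ?_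
    rw [Finset.sup_lt_iff (by simp [bot_lt_iff_ne_bot])]
    intro c _
    simpa using bpoly_degree_lt u hr c
  · simpa [degree_one] using Nat.pos_of_ne_zero (by omega)
  · intro c' _
    simp [eval_finsetSum, bpoly_eval u hu]

theorem adjoin_range_coord (hu : ∀ i j, i ≠ j → IsUnit (u i - u j)) :
    Algebra.adjoin R (Set.range (coord u : Fin n → (Fin n → Fin r) → R)) = ⊤ := by
  rw [eq_top_iff]
  rintro f -
  have hf : f = ∑ k, f k • ∏ i, aeval (coord u i : (Fin n → Fin r) → R) (bpoly R r u (k i)) := by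
    ext l
    simp only [Finset.sum_apply, Pi.smul_apply, Finset.prod_apply, aeval_pi_apply, coord,
      bpoly_eval u hu, smul_eq_mul]
    rw [Finset.sum_eq_single l]
    · simp
    · intro k _ hk
      obtain ⟨i, hi⟩ := Function.ne_iff.1 hk
      rw [Finset.prod_eq_zero (Finset.mem_univ i) (if_neg (Ne.symm hi)), mul_zero]
    · simp
  rw [hf]
  refine Subalgebra.sum_mem _ fun k _ =>
    Subalgebra.smul_mem _ (Subalgebra.prod_mem _ fun i _ => ?_) _
  exact aeval_mem_adjoin_singleton R _ |> Algebra.adjoin_mono (by simp)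

@[simp] theorem simple_lo (j : Fin (n - 1)) : simple n j (lo n j) = hi n j :=
  Equiv.swap_apply_left _ _

@[simp] theorem simple_hi (j : Fin (n - 1)) : simple n j (hi n j) = lo n j :=
  Equiv.swap_apply_right _ _

theorem simple_of_ne (j : Fin (n - 1)) {i : Fin n} (h1 : i ≠ lo n j) (h2 : i ≠ hi n j) :
    simple n j i = i := Equiv.swap_apply_of_ne_of_ne h1 h2

theorem map_Bel {A : Type*} [Ring A] [Algebra R A]
    (hFeval : ∀ c c' : Fin r, (F c).eval (u c') = if c' = c then (Δ : R) else 0)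
    (θ : FA R n →ₐ[R] A) (ψ : ((Fin n → Fin r) → R) →ₐ[R] A)
    (h : ∀ i, θ (tf R n i) = ψ (coord u i)) (j : Fin (n - 1)) :
    θ (Bel R n r q Δ u F j) =
      ψ (ltFun q (lo n j) (hi n j) * (coord u (hi n j) - coord u (lo n j))) := by
  simp only [Bel, map_sum, map_smul, map_mul, ← aeval_algHom_apply, h]
  simp only [aeval_algHom_apply, ← map_mul, ← map_smul, ← map_sum]
  congr 1
  ext k
  simp only [Finset.sum_apply, Pi.smul_apply, Pi.mul_apply, Pi.sub_apply, aeval_pi_apply, coord,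
    hFeval, smul_eq_mul, ltFun]
  rw [Finset.sum_eq_single (k (hi n j))]
  · rw [Finset.sum_filter, Finset.sum_eq_single (k (lo n j))]
    · have : ((Δ⁻¹ : Rˣ) : R) ^ 2 * ((Δ : R) * Δ) = 1 := by
        rw [← sq, ← mul_pow, Units.inv_mul, one_pow]
      by_cases hk : k (lo n j) < k (hi n j)
      · simp only [hk, if_true]
        linear_combination
          (u (k (hi n j)) - u (k (lo n j))) * ((q : R) - ((q⁻¹ : Rˣ) : R)) * this
      · simp [hk]
    · intro c _ hc
      simp [Ne.symm hc]
    · simp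
  · intro c _ hc
    simp [Ne.symm hc]
  · simp

end Functions

section Presentation

variable {R : Type*} [CommRing R] {n r : ℕ} (q : Rˣ)
  {A : Type*} [Ring A] [Algebra R A]

/-- Elements `g_j` of an algebra act on the image of the algebra of functions on labels by
permuting positions. -/
def Permutes (ψ : ((Fin n → Fin r) → R) →ₐ[R] A) (γ : Fin (n - 1) → A) : Prop :=
  ∀ j f, γ j * ψ f = ψ (fun k => f (k ∘ simple n j)) * γ j

/-- The presentation of the modified Ariki-Koike algebra by the functions on labels and the `g_j`,
which does not involve the order of the labels. -/
structure SymmRel (ψ : ((Fin n → Fin r) → R) →ₐ[R] A) (γ : Fin (n - 1) → A) : Prop where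
  permutes : Permutes ψ γ
  quad : ∀ j, γ j * γ j = 1 + ψ (eqFun q (lo n j) (hi n j)) * γ j
  braid : ∀ j k : Fin (n - 1), k.1 = j.1 + 1 → γ j * γ k * γ j = γ k * γ j * γ k
  comm : ∀ j k : Fin (n - 1), (j.1 + 2 ≤ k.1 ∨ k.1 + 2 ≤ j.1) → γ j * γ k = γ k * γ j

variable {q} {ψ : ((Fin n → Fin r) → R) →ₐ[R] A} {γ : Fin (n - 1) → A}

theorem Permutes.mul_ltFun (h : Permutes ψ γ) (j : Fin (n - 1)) (i i' : Fin n) :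
    γ j * ψ (ltFun q i i') = ψ (ltFun q (simple n j i) (simple n j i')) * γ j := h j _

theorem Permutes.quad_iff (h : Permutes ψ γ) (j : Fin (n - 1)) :
    (γ j + ψ (ltFun q (lo n j) (hi n j)) - algebraMap R A q) *
        (γ j + ψ (ltFun q (lo n j) (hi n j)) + algebraMap R A ((q⁻¹ : Rˣ) : R)) = 0 ↔
      γ j * γ j = 1 + ψ (eqFun q (lo n j) (hi n j)) * γ j := by
  have h1 := h.mul_ltFun (q := q) j (lo n j) (hi n j)
  rw [simple_lo, simple_hi] at h1
  have h2 : ψ (ltFun q (lo n j) (hi n j)) + ψ (ltFun q (hi n j) (lo n j)) +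
      ψ (eqFun q (lo n j) (hi n j)) = ψ (algebraMap R _ ((q : R) - ((q⁻¹ : Rˣ) : R))) := by
    rw [← map_add, ← map_add]
    congr 1
    ext k
    rcases lt_trichotomy (k (lo n j)) (k (hi n j)) with hk | hk | hk
    · simp [ltFun, eqFun, hk, hk.not_gt, hk.ne]
    · simp [ltFun, eqFun, hk]
    · simp [ltFun, eqFun, hk, hk.not_gt, hk.ne']
  have h3 : ψ (ltFun q (lo n j) (hi n j)) * ψ (ltFun q (lo n j) (hi n j)) =
      ψ (algebraMap R _ ((q : R) - ((q⁻¹ : Rˣ) : R))) * ψ (ltFun q (lo n j) (hi n j)) := by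
    rw [← map_mul, ← map_mul]
    congr 1
    ext k
    by_cases hk : k (lo n j) < k (hi n j) <;> simp [ltFun, hk]
  rw [AlgHom.commutes, map_sub] at h2 h3
  have h4 : algebraMap R A (q : R) * algebraMap R A ((q⁻¹ : Rˣ) : R) = 1 := by
    rw [← map_mul, Units.mul_inv, map_one]
  have c1 := Algebra.commutes ((q⁻¹ : Rˣ) : R) (γ j)
  have c2 := Algebra.commutes ((q⁻¹ : Rˣ) : R) (ψ (ltFun q (lo n j) (hi n j)))
  rw [← sub_eq_zero (a := γ j * γ j)]
  generalize ψ (ltFun q (lo n j) (hi n j)) = x at *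
  generalize ψ (ltFun q (hi n j) (lo n j)) = y at *
  generalize ψ (eqFun q (lo n j) (hi n j)) = e at *
  generalize algebraMap R A (q : R) = s at *
  generalize algebraMap R A ((q⁻¹ : Rˣ) : R) = t at *
  generalize γ j = z at *
  have : (z + x - s) * (z + x + t) = z * z - (1 + e * z) := by
    have h5 := congrArg (· * z) h2
    simp only [add_mul, sub_mul] at h5 h3
    have : (z + x - s) * (z + x + t) = z * z + z * x + x * z + x * x + z * t + x * t - s * z
        - s * x - s * t := by noncomm_ring
    rw [this, h1, h3, h4, ← c1, ← c2, sub_add_eq_sub_sub]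
    have h6 : e * z = s * z - t * z - x * z - y * z := by rw [← h5]; abel
    rw [h6]
    abel
  rw [this]

theorem Permutes.braid_iff (h : Permutes ψ γ)
    (hq : ∀ j, γ j * γ j = 1 + ψ (eqFun q (lo n j) (hi n j)) * γ j)
    (j k : Fin (n - 1)) (hjk : k.1 = j.1 + 1) :
    (γ j + ψ (ltFun q (lo n j) (hi n j))) * (γ k + ψ (ltFun q (lo n k) (hi n k))) *
        (γ j + ψ (ltFun q (lo n j) (hi n j))) =
      (γ k + ψ (ltFun q (lo n k) (hi n k))) * (γ j + ψ (ltFun q (lo n j) (hi n j))) *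
        (γ k + ψ (ltFun q (lo n k) (hi n k))) ↔
      γ j * γ k * γ j = γ k * γ j * γ k := by
  have hlo : lo n k = hi n j := Fin.ext hjk
  have hqk := hq k
  have hj3 : simple n j (hi n k) = hi n k :=
    simple_of_ne j (by simp [lo, hi, hjk, Fin.ext_iff]; omega)
      (by simp [hi, hjk, Fin.ext_iff])
  have hk1 : simple n k (lo n j) = lo n j :=
    simple_of_ne k (by simp [lo, hjk, Fin.ext_iff]) (by simp [lo, hi, hjk, Fin.ext_iff]; omega)
  have hk2 : simple n k (hi n j) = hi n k := by rw [← hlo, simple_lo]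
  have hk3 : simple n k (hi n k) = hi n j := by rw [simple_hi, hlo]
  rw [hlo] at hqk ⊢
  rw [← sub_eq_zero, ← sub_eq_zero (a := γ j * γ k * γ j)]
  rw [braid_sub_braid (γ j) (γ k) _ (ψ (ltFun q (lo n j) (hi n k))) _
    (ψ (ltFun q (hi n j) (lo n j))) (ψ (ltFun q (hi n k) (hi n j)))
    (ψ (eqFun q (lo n j) (hi n j))) (ψ (eqFun q (hi n j) (hi n k)))]
  · rw [h.mul_ltFun, simple_hi, hj3]
  · rw [h.mul_ltFun, simple_hi, simple_lo]
  · rw [h.mul_ltFun, simple_lo, hj3]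
  · rw [h.mul_ltFun, hk1, hk2]
  · rw [h.mul_ltFun, hk1, hk3]
  · rw [h.mul_ltFun, hk2, hk3]
  · exact hq j
  · exact hqk
  all_goals
    simp only [← map_mul, ← map_add]
    congr 1
    ext l
    simp only [Pi.mul_apply, Pi.add_apply, ltFun, eqFun]
    generalize l (lo n j) = x
    generalize l (hi n j) = y
    generalize l (hi n k) = z
    split_ifs <;> first | (exfalso; order) | ring

theorem Permutes.comm_iff (h : Permutes ψ γ) (j k : Fin (n - 1))
    (hjk : j.1 + 2 ≤ k.1 ∨ k.1 + 2 ≤ j.1) :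
    (γ j + ψ (ltFun q (lo n j) (hi n j))) * (γ k + ψ (ltFun q (lo n k) (hi n k))) =
      (γ k + ψ (ltFun q (lo n k) (hi n k))) * (γ j + ψ (ltFun q (lo n j) (hi n j))) ↔
      γ j * γ k = γ k * γ j := by
  have h1 : γ j * ψ (ltFun q (lo n k) (hi n k)) = ψ (ltFun q (lo n k) (hi n k)) * γ j := by
    rw [h.mul_ltFun, simple_of_ne, simple_of_ne] <;>
      simp only [lo, hi, ne_eq, Fin.mk.injEq] <;> omega
  have h2 : γ k * ψ (ltFun q (lo n j) (hi n j)) = ψ (ltFun q (lo n j) (hi n j)) * γ k := by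
    rw [h.mul_ltFun, simple_of_ne, simple_of_ne] <;>
      simp only [lo, hi, ne_eq, Fin.mk.injEq] <;> omega
  have h3 : ψ (ltFun q (lo n j) (hi n j)) * ψ (ltFun q (lo n k) (hi n k)) =
      ψ (ltFun q (lo n k) (hi n k)) * ψ (ltFun q (lo n j) (hi n j)) := by
    rw [← map_mul, mul_comm, map_mul]
  rw [← sub_eq_zero, ← sub_eq_zero (a := γ j * γ k)]
  simp only [mul_add, add_mul, h1, h2, h3]
  refine iff_of_eq (congrArg (· = 0) ?_)
  abel

/-- The automorphism of the algebra of functions on labels induced by a permutation of the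
values. -/
def permuteValues (σ : Equiv.Perm (Fin r)) : ((Fin n → Fin r) → R) →ₐ[R] ((Fin n → Fin r) → R) :=
  AlgHom.pi fun k => Pi.evalAlgHom R _ fun i => σ⁻¹ (k i)

theorem permuteValues_single (σ : Equiv.Perm (Fin r)) (k : Fin n → Fin r) :
    permuteValues σ (Pi.single k (1 : R)) = Pi.single (fun i => σ (k i)) 1 := by
  ext l
  have : ((fun i => σ⁻¹ (l i)) = k) = (l = fun i => σ (k i)) := by
    simp only [funext_iff, Equiv.Perm.inv_eq_iff_eq]
  simp only [permuteValues, AlgHom.pi_apply, Pi.evalAlgHom_apply, Pi.single_apply, this]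

/-- Permuting the values of the labels preserves the symmetric presentation. -/
theorem SymmRel.permuteValues (h : SymmRel q ψ γ) (σ : Equiv.Perm (Fin r)) :
    SymmRel q (ψ.comp (permuteValues σ)) γ where
  permutes j f := h.permutes j (MAK.permuteValues σ f)
  quad j := by
    have : MAK.permuteValues σ (eqFun q (lo n j) (hi n j)) = eqFun q (lo n j) (hi n j) := by
      ext k
      simp [MAK.permuteValues, eqFun]
    rw [AlgHom.comp_apply, this, h.quad]
  braid := h.braid
  comm := h.comm

variable {Δ : Rˣ} {u : Fin r → R} {F : Fin r → R[X]}

theorem SymmRel.exists_lift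
    (hFeval : ∀ c c' : Fin r, (F c).eval (u c') = if c' = c then (Δ : R) else 0)
    (h : SymmRel q ψ γ) :
    ∃ θ : Hnr R n r q Δ u F →ₐ[R] A, (∀ i, θ (tt R n r q Δ u F i) = ψ (coord u i)) ∧
      ∀ j, θ (TT R n r q Δ u F j) = γ j + ψ (ltFun q (lo n j) (hi n j)) := by
  let θ₀ : FA R n →ₐ[R] A := FreeAlgebra.lift R
    (Sum.elim (fun i => ψ (coord u i)) fun j => γ j + ψ (ltFun q (lo n j) (hi n j)))
  have ht (i) : θ₀ (tf R n i) = ψ (coord u i) := FreeAlgebra.lift_ι_apply _ _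
  have hT (j) : θ₀ (Tf R n j) = γ j + ψ (ltFun q (lo n j) (hi n j)) :=
    FreeAlgebra.lift_ι_apply _ _
  have hB := map_Bel q Δ u F hFeval θ₀ ψ ht
  have hcomm (f f' : (Fin n → Fin r) → R) : ψ f * ψ f' = ψ f' * ψ f := by
    rw [← map_mul, mul_comm, map_mul]
  have hγ (j i) : γ j * ψ (coord u i) = ψ (coord u (simple n j i)) * γ j :=
    h.permutes j (coord u i)
  have hrel : ∀ ⦃x y⦄, Rel R n r q Δ u F x y → θ₀ x = θ₀ y := by
    intro x y hxy
    induction hxy with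
    | quad j =>
      simp only [map_mul, map_sub, map_add, hT, AlgHom.commutes, map_zero]
      exact (h.permutes.quad_iff j).2 (h.quad j)
    | tord i =>
      rw [map_zero, ← aeval_algHom_apply, ht, aeval_algHom_apply]
      convert map_zero ψ
      ext k
      rw [aeval_pi_apply, eval_prod, Finset.prod_eq_zero (Finset.mem_univ (k i)) (by simp [coord])]
      rfl
    | braid j k hjk =>
      simp only [map_mul, hT]
      exact (h.permutes.braid_iff h.quad j k hjk).2 (h.braid j k hjk)
    | Tcomm j k hjk =>
      simp only [map_mul, hT]
      exact (h.permutes.comm_iff j k hjk).2 (h.comm j k hjk)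
    | tcomm i i' => simp only [map_mul, ht, hcomm]
    | Tt j i h1 h2 =>
      simp only [map_mul, ht, hT, add_mul, mul_add, hγ, simple_of_ne j h1 h2, hcomm (ltFun _ _ _)]
    | Thi j =>
      simp only [map_mul, map_add, map_sub, mul_sub, ht, hT, hB, add_mul, mul_add, hγ, simple_hi,
        hcomm (ltFun _ _ _)]
      abel
    | Tlo j =>
      simp only [map_mul, map_sub, mul_sub, ht, hT, hB, add_mul, mul_add, hγ, simple_lo,
        hcomm (ltFun _ _ _)]
      abel
  refine ⟨RingQuot.liftAlgHom R ⟨θ₀, hrel⟩, fun i => ?_, fun j => ?_⟩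
  · rw [tt, pim, RingQuot.liftAlgHom_mkAlgHom_apply, ht]
  · rw [TT, pim, RingQuot.liftAlgHom_mkAlgHom_apply, hT]

end Presentation

section Labels

variable {R : Type*} [CommRing R] {n r : ℕ} {q Δ : Rˣ} {u : Fin r → R} {F : Fin r → R[X]}

theorem tt_comm (i i' : Fin n) : tt R n r q Δ u F i * tt R n r q Δ u F i' =
    tt R n r q Δ u F i' * tt R n r q Δ u F i := by
  simpa [tt, pim] using RingQuot.mkAlgHom_rel R (Rel.tcomm (F := F) (u := u) (q := q) (Δ := Δ) i i')

theorem tt_mul_b (i : Fin n) (k : Fin n → Fin r) :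
    tt R n r q Δ u F i * b R n r q Δ u F k = u (k i) • b R n r q Δ u F k := by
  refine mul_prod_ofFn_of_commute _ _ _ (fun i' => ?_) i ?_
  · exact commute_aeval (tt_comm i i') _
  · obtain ⟨s, hs⟩ := sub_mul_bpoly u (k i)
    have h0 : aeval (tt R n r q Δ u F i) (∏ c : Fin r, (X - C (u c))) = 0 := by
      have := RingQuot.mkAlgHom_rel R (Rel.tord (F := F) (u := u) (q := q) (Δ := Δ) i)
      rwa [map_zero, ← aeval_algHom_apply] at this
    have := congrArg (aeval (tt R n r q Δ u F i)) hs
    rwa [map_smul, h0, smul_zero, map_mul, map_sub, aeval_X, aeval_C, sub_mul, sub_eq_zero,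
      ← Algebra.smul_def] at this

theorem b_mul_b (hu : ∀ i j, i ≠ j → IsUnit (u i - u j)) (k l : Fin n → Fin r) :
    b R n r q Δ u F k * b R n r q Δ u F l =
      (if l = k then (1 : R) else 0) • b R n r q Δ u F l := by
  rw [b, prod_ofFn_mul_of_forall _ (fun i => if l i = k i then (1 : R) else 0)]
  · congr 1
    rw [Finset.prod_ite_zero]
    simp [funext_iff]
  · intro i
    rw [aeval_mul_of_mul_eq_smul (tt_mul_b i l), bpoly_eval u hu]

theorem sum_b [IsDomain R] (hr : 1 ≤ r) (hu : ∀ i j, i ≠ j → IsUnit (u i - u j)) :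
    ∑ k, b R n r q Δ u F k = 1 := by
  simp only [b]
  rw [← prod_ofFn_sum fun i c => aeval (tt R n r q Δ u F i) (bpoly R r u c)]
  simp [← map_sum, sum_bpoly u hr hu]

/-- The embedding of the algebra of functions on labels, sending the indicator function of `k` to
`b_k`. -/
def labelHom [IsDomain R] (q Δ : Rˣ) (F : Fin r → R[X]) (hr : 1 ≤ r)
    (hu : ∀ i j, i ≠ j → IsUnit (u i - u j)) :
    ((Fin n → Fin r) → R) →ₐ[R] Hnr R n r q Δ u F :=
  AlgHom.ofLinearMap
    (∑ k, (LinearMap.proj k : ((Fin n → Fin r) → R) →ₗ[R] R).smulRight (b R n r q Δ u F k))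
    (by simp [sum_b hr hu])
    (fun f f' => by
      simp [Finset.sum_mul_sum, b_mul_b hu, smul_smul, mul_comm])

theorem algHom_ext_tt_TT {A : Type*} [Ring A] [Algebra R A] {φ φ' : Hnr R n r q Δ u F →ₐ[R] A}
    (ht : ∀ i, φ (tt R n r q Δ u F i) = φ' (tt R n r q Δ u F i))
    (hT : ∀ j, φ (TT R n r q Δ u F j) = φ' (TT R n r q Δ u F j)) : φ = φ' := by
  refine RingQuot.ringQuot_ext' _ _ _ (FreeAlgebra.hom_ext (funext ?_))
  rintro (i | j)
  · exact ht i
  · exact hT j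

variable [IsDomain R] (hr : 1 ≤ r) (hu : ∀ i j, i ≠ j → IsUnit (u i - u j))

theorem labelHom_apply (f : (Fin n → Fin r) → R) :
    labelHom q Δ F hr hu f = ∑ k, f k • b R n r q Δ u F k := by
  simp [labelHom]

theorem labelHom_single (k : Fin n → Fin r) :
    labelHom q Δ F hr hu (Pi.single k 1) = b R n r q Δ u F k := by
  simp [labelHom_apply, Pi.single_apply]

theorem labelHom_coord (i : Fin n) : labelHom q Δ F hr hu (coord u i) = tt R n r q Δ u F i := by
  rw [← mul_one (tt R n r q Δ u F i), ← sum_b hr hu, Finset.mul_sum, labelHom_apply]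
  simp only [tt_mul_b, coord]

theorem TT_eq (j : Fin (n - 1)) : TT R n r q Δ u F j =
    g R n r q Δ u F j + labelHom q Δ F hr hu (ltFun q (lo n j) (hi n j)) := by
  rw [g, B', labelHom_apply, add_assoc, left_eq_add, neg_add_eq_zero, Finset.smul_sum,
    Finset.sum_filter]
  simp [ltFun, ite_smul]

theorem symmRel_labelHom
    (hFeval : ∀ c c' : Fin r, (F c).eval (u c') = if c' = c then (Δ : R) else 0) :
    SymmRel q (labelHom q Δ F hr hu) (g R n r q Δ u F) := by
  have ht (i) := labelHom_coord (n := n) (q := q) (Δ := Δ) (F := F) hr hu i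
  have hT (j) := TT_eq (n := n) (q := q) (Δ := Δ) (F := F) hr hu j
  have hcomm (f f' : (Fin n → Fin r) → R) : labelHom q Δ F hr hu f * labelHom q Δ F hr hu f' =
      labelHom q Δ F hr hu f' * labelHom q Δ F hr hu f := by
    rw [← map_mul, mul_comm, map_mul]
  have hB := map_Bel q Δ u F hFeval (pim R n r q Δ u F) (labelHom q Δ F hr hu)
    fun i => (ht i).symm
  have hrel : ∀ ⦃x y⦄, Rel R n r q Δ u F x y → pim R n r q Δ u F x = pim R n r q Δ u F y :=
    fun x y h => RingQuot.mkAlgHom_rel R h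
  have hpt (i) : pim R n r q Δ u F (tf R n i) = labelHom q Δ F hr hu (coord u i) := (ht i).symm
  have hpT (j) : pim R n r q Δ u F (Tf R n j) =
    g R n r q Δ u F j + labelHom q Δ F hr hu (ltFun q (lo n j) (hi n j)) := hT j
  have hgt (j i) : g R n r q Δ u F j * labelHom q Δ F hr hu (coord u i) =
      labelHom q Δ F hr hu (coord u (simple n j i)) * g R n r q Δ u F j := by
    by_cases h1 : i = lo n j
    · subst h1
      have := hrel (.Tlo j)
      simp only [map_mul, map_sub, mul_sub, hpt, hpT, hB, add_mul, mul_add,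
        hcomm (ltFun _ _ _)] at this
      rw [simple_lo, ← sub_eq_zero, ← sub_eq_zero.2 this]
      abel
    by_cases h2 : i = hi n j
    · subst h2
      have := hrel (.Thi j)
      simp only [map_mul, map_add, map_sub, mul_sub, hpt, hpT, hB, add_mul, mul_add,
        hcomm (ltFun _ _ _)] at this
      rw [simple_hi, ← sub_eq_zero, ← sub_eq_zero.2 this]
      abel
    · have := hrel (.Tt j i h1 h2)
      simp only [map_mul, hpt, hpT, add_mul, mul_add, hcomm (ltFun _ _ _)] at this
      rw [simple_of_ne j h1 h2]
      exact add_right_cancel this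
  have hperm : Permutes (labelHom q Δ F hr hu) (g R n r q Δ u F) := by
    intro j f
    have hf : f ∈ Algebra.adjoin R (Set.range (coord u : Fin n → (Fin n → Fin r) → R)) := by
      rw [adjoin_range_coord u hu]; trivial
    induction hf using Algebra.adjoin_induction with
    | mem f hf =>
      obtain ⟨i, rfl⟩ := hf
      exact hgt j i
    | algebraMap s =>
      rw [AlgHom.commutes]
      exact ((Algebra.commutes s _).symm).trans
        (congrArg (· * g R n r q Δ u F j) ((labelHom q Δ F hr hu).commutes s).symm)
    | add f f' _ _ h h' =>
      rw [map_add, mul_add, h, h', ← add_mul, ← map_add]; rfl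
    | mul f f' _ _ h h' =>
      rw [map_mul, ← mul_assoc, h, mul_assoc, h', ← mul_assoc, ← map_mul]; rfl
  have hquad (j) := (hperm.quad_iff (q := q) j).1 <| by
    simpa [hpT] using hrel (.quad j)
  refine ⟨hperm, hquad, fun j k hjk => ?_, fun j k hjk => ?_⟩
  · refine (hperm.braid_iff hquad j k hjk).1 ?_
    simpa [hpT] using hrel (.braid j k hjk)
  · refine (hperm.comm_iff (q := q) j k hjk).1 ?_
    simpa [hpT] using hrel (.Tcomm j k hjk)

theorem algHom_ext_b_g (hr : 1 ≤ r) (hu : ∀ i j, i ≠ j → IsUnit (u i - u j))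
    {A : Type*} [Ring A] [Algebra R A] {φ φ' : Hnr R n r q Δ u F →ₐ[R] A}
    (hb : ∀ k, φ (b R n r q Δ u F k) = φ' (b R n r q Δ u F k))
    (hg : ∀ j, φ (g R n r q Δ u F j) = φ' (g R n r q Δ u F j)) : φ = φ' := by
  have h (f) : φ (labelHom q Δ F hr hu f) = φ' (labelHom q Δ F hr hu f) := by
    simp only [labelHom_apply, map_sum, map_smul, hb]
  refine algHom_ext_tt_TT (fun i => ?_) (fun j => ?_)
  · rw [← labelHom_coord hr hu, h]
  · rw [TT_eq hr hu, map_add, map_add, h, hg]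

theorem exists_algHom_permuting
    (hr : 1 ≤ r) (hu : ∀ i j, i ≠ j → IsUnit (u i - u j))
    (hFeval : ∀ c c' : Fin r, (F c).eval (u c') = if c' = c then (Δ : R) else 0)
    (σ : Equiv.Perm (Fin r)) :
    ∃ φ : Hnr R n r q Δ u F →ₐ[R] Hnr R n r q Δ u F,
      (∀ k, φ (b R n r q Δ u F k) = b R n r q Δ u F (fun i => σ (k i))) ∧
      ∀ j, φ (g R n r q Δ u F j) = g R n r q Δ u F j := by
  obtain ⟨φ, ht, hT⟩ :=
    ((symmRel_labelHom (n := n) (q := q) hr hu hFeval).permuteValues σ).exists_lift hFeval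
  have hφ : φ.comp (labelHom q Δ F hr hu) = (labelHom q Δ F hr hu).comp (permuteValues σ) := by
    refine AlgHom.ext_of_adjoin_eq_top (adjoin_range_coord u hu) ?_
    rintro _ ⟨i, rfl⟩
    rw [AlgHom.comp_apply, labelHom_coord, ht]
  refine ⟨φ, fun k => ?_, fun j => ?_⟩
  · rw [← labelHom_single hr hu, ← AlgHom.comp_apply, hφ, AlgHom.comp_apply, permuteValues_single,
      labelHom_single]
  · have := hT j
    rw [TT_eq hr hu, map_add, ← AlgHom.comp_apply φ, hφ] at this
    exact add_right_cancel this

end Labels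

end

end MAK


/-- Proposition 5.1: the symmetric group `S_r` acts on `H_{n,r}` by `R`-algebra
automorphisms fixing the `g_i` and permuting the idempotents `b_{k_1,…,k_n}`. -/
theorem statement18
    (R : Type*) [CommRing R] [IsDomain R] (n r : ℕ) (hn : 1 ≤ n) (hr : 1 ≤ r)
    (q Δ : Rˣ) (u : Fin r → R) (F : Fin r → R[X])
    (hΔ : (Δ : R) = ∏ i : Fin r, ∏ j ∈ Finset.univ.filter (fun j => j < i), (u i - u j))
    (hFdeg : ∀ c : Fin r, (F c).degree = ((r - 1 : ℕ) : WithBot ℕ))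
    (hFeval : ∀ c c' : Fin r, (F c).eval (u c') = if c' = c then (Δ : R) else 0) :
    (∀ σ : Equiv.Perm (Fin r),
      ∃! φ : Hnr R n r q Δ u F ≃ₐ[R] Hnr R n r q Δ u F,
        (∀ k : Fin n → Fin r, φ (b R n r q Δ u F k) = b R n r q Δ u F (fun i => σ (k i))) ∧
        (∀ j : Fin (n - 1), φ (g R n r q Δ u F j) = g R n r q Δ u F j)) ∧
    (∃ Φ : Equiv.Perm (Fin r) →* (Hnr R n r q Δ u F ≃ₐ[R] Hnr R n r q Δ u F),
      ∀ σ : Equiv.Perm (Fin r),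
        (∀ k : Fin n → Fin r, Φ σ (b R n r q Δ u F k) = b R n r q Δ u F (fun i => σ (k i))) ∧
        (∀ j : Fin (n - 1), Φ σ (g R n r q Δ u F j) = g R n r q Δ u F j)) := by
  have hu : ∀ i j, i ≠ j → IsUnit (u i - u j) := fun i j => isUnit_sub_of_prod Δ u hΔ
  choose φ hφb hφg using exists_algHom_permuting (n := n) (q := q) hr hu hFeval
  have h_mul (σ τ : Equiv.Perm (Fin r)) : φ (σ * τ) = (φ σ).comp (φ τ) :=
    algHom_ext_b_g hr hu (by simp [hφb]) (by simp [hφg])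
  have h_one : φ 1 = AlgHom.id R _ := algHom_ext_b_g hr hu (by simp [hφb]) (by simp [hφg])
  let Φ (σ : Equiv.Perm (Fin r)) : Hnr R n r q Δ u F ≃ₐ[R] Hnr R n r q Δ u F :=
    AlgEquiv.ofAlgHom (φ σ) (φ σ⁻¹) (by rw [← h_mul, mul_inv_cancel, h_one])
      (by rw [← h_mul, inv_mul_cancel, h_one])
  refine ⟨fun σ => ⟨Φ σ, ⟨hφb σ, hφg σ⟩, ?_⟩,
    ⟨⟨Φ, AlgEquiv.ext fun x => DFunLike.congr_fun h_one x⟩,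
      fun σ τ => AlgEquiv.ext fun x => DFunLike.congr_fun (h_mul σ τ) x⟩,
    fun σ => ⟨hφb σ, hφg σ⟩⟩
  rintro ψ ⟨hb, hg⟩
  have h : (ψ : Hnr R n r q Δ u F →ₐ[R] Hnr R n r q Δ u F) = φ σ :=
    algHom_ext_b_g hr hu (fun k => (hb k).trans (hφb σ k).symm)
      (fun j => (hg j).trans (hφg σ j).symm)
  exact AlgEquiv.ext fun x => DFunLike.congr_fun h x
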